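/- There exists a real constant D such that for every n the following holds. In the saturation game (n, χ_{>3}), where χ_{>3} is the property of having chromatic number at least 4, Mini has a strategy (regardless of whether she moves first or second) guaranteeing that the graph at the end of the game has at most 21n²/64 + D·n edges; in particular s(n, χ_{>3}) ≤ 21n²/64 + O(n). -/

import Mathlib

open SimpleGraph

/-- The graph obtained from `G` by adding the edge `e`. -/
def addEdge {V : Type*} (G : SimpleGraph V) (e : Sym2 V) : SimpleGraph V :=
  G ⊔ SimpleGraph.fromEdgeSet {e}

/-- In the saturation game for the monotone property `P`, a move `e` is legal in
position `G` if `e` is a non-loop non-edge of `G` whose addition keeps `P` unsatisfied. -/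
def legalMove {V : Type*} (P : SimpleGraph V → Prop) (G : SimpleGraph V) (e : Sym2 V) : Prop :=
  ¬ e.IsDiag ∧ e ∉ G.edgeSet ∧ ¬ P (addEdge G e)

/-- `GameEnsures P Q turn G` : in the saturation game for the property `P`, played from
position `G` where the protagonist is to move iff `turn = true`, the protagonist has a
strategy guaranteeing that the final (`P`-saturated) graph satisfies `Q`. -/
inductive GameEnsures {V : Type*} (P Q : SimpleGraph V → Prop) : Bool → SimpleGraph V → Prop
  | gameOver (turn : Bool) (G : SimpleGraph V)
      (hend : ∀ e, ¬ legalMove P G e) (hQ : Q G) : GameEnsures P Q turn G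
  | protagonistMove (G : SimpleGraph V) (e : Sym2 V) (hl : legalMove P G e)
      (h : GameEnsures P Q false (addEdge G e)) : GameEnsures P Q true G
  | opponentMove (G : SimpleGraph V) (e₀ : Sym2 V) (hl : legalMove P G e₀)
      (h : ∀ e, legalMove P G e → GameEnsures P Q true (addEdge G e)) :
      GameEnsures P Q false G

/-- The property of having chromatic number at least `k + 1`. -/
def chiGt {V : Type*} (k : ℕ) (G : SimpleGraph V) : Prop :=
  ((k : ℕ∞) + 1) ≤ G.chromaticNumber

/-! ### Basic facts about moves -/

theorem not_chiGt_iff {V : Type*} {k : ℕ} {G : SimpleGraph V} : ¬ chiGt k G ↔ G.Colorable k := by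
  rw [← chromaticNumber_le_iff_colorable, chiGt, not_le]
  exact ENat.lt_natCast_add_one_iff

theorem addEdge_adj {V : Type*} {G : SimpleGraph V} {x y p q : V} :
    (addEdge G s(x, y)).Adj p q ↔
      G.Adj p q ∨ ((p = x ∧ q = y ∨ p = y ∧ q = x) ∧ p ≠ q) := by
  simp only [addEdge, sup_adj, fromEdgeSet_adj, Set.mem_singleton_iff, Sym2.eq_iff]

theorem lt_addEdge {V : Type*} {P : SimpleGraph V → Prop} {G : SimpleGraph V} {e : Sym2 V}
    (h : legalMove P G e) : G < addEdge G e := by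
  refine lt_of_le_of_ne le_sup_left fun hG => h.2.1 ?_
  rw [hG, addEdge, edgeSet_sup, edgeSet_fromEdgeSet]
  exact Or.inr ⟨rfl, h.1⟩

theorem colorable_addEdge {V : Type*} {G : SimpleGraph V} {k : ℕ} {x y : V}
    (c : G.Coloring (Fin k)) (h : c x ≠ c y) : (addEdge G s(x, y)).Colorable k := by
  refine ⟨Coloring.mk c fun {p q} hpq => ?_⟩
  rcases addEdge_adj.1 hpq with hpq | ⟨⟨rfl, rfl⟩ | ⟨rfl, rfl⟩, -⟩
  exacts [c.valid hpq, h, h.symm]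

/-! ### The potential of a position with respect to a root vertex -/

section Potential

open scoped Classical in
/-- The number of common neighbours of `a` and `v`. -/
noncomputable def commonDeg {V : Type*} [Fintype V] (G : SimpleGraph V) (a v : V) : ℕ :=
  (Finset.univ.filter fun u => G.Adj a u ∧ G.Adj v u).card

/-- The weight of a non-neighbour of the root having `d` common neighbours with it. -/
def weight (d : ℕ) : ℤ := if d = 0 then 0 else if d = 1 then 1 else 3

open scoped Classical in
/-- The contribution of the vertex `v` to the potential. -/
noncomputable def localPotential {V : Type*} [Fintype V] (G : SimpleGraph V) (a v : V) : ℤ :=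
  if v = a then 0 else if G.Adj a v then 1 else - weight (commonDeg G a v)

/-- The degree of the root minus the total weight of its non-neighbours. -/
noncomputable def potential {V : Type*} [Fintype V] (G : SimpleGraph V) (a : V) : ℤ :=
  ∑ v, localPotential G a v

/-- The vertex `v` is neither the root `a` nor adjacent to it. -/
def Far {V : Type*} (G : SimpleGraph V) (a v : V) : Prop := v ≠ a ∧ ¬ G.Adj a v

/-- The non-neighbours of `a` form an independent set. -/
def FarIndep {V : Type*} (G : SimpleGraph V) (a : V) : Prop :=
  ∀ p q, Far G a p → Far G a q → ¬ G.Adj p q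

/-- If a non-neighbour `p` of `a` has exactly one common neighbour `u` with `a`, then `u` has no
neighbours besides `a` and `p`. -/
def Clean {V : Type*} (G : SimpleGraph V) (a : V) : Prop :=
  ∀ p u, Far G a p → G.Adj a u → G.Adj p u → (∀ u', G.Adj a u' → G.Adj p u' → u' = u) →
    ∀ w, G.Adj u w → w = a ∨ w = p

/-- The invariant maintained by Mini, who keeps joining vertices to `a`. -/
structure MiniInvariant {V : Type*} [Fintype V] (G : SimpleGraph V) (a : V) : Prop where
  colorable : G.Colorable 3
  indep : FarIndep G a
  nonneg : 0 ≤ potential G a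
  pos_or_clean : 1 ≤ potential G a ∨ Clean G a

open scoped Classical in
/-- The degree of `a` is at least three quarters of the number of vertices, up to a constant. -/
def LargeDegree {V : Type*} [Fintype V] (G : SimpleGraph V) (a : V) : Prop :=
  3 * Fintype.card V ≤ 4 * (Finset.univ.filter fun v => G.Adj a v).card + 4

variable {V : Type*} {G G' : SimpleGraph V} {a : V}

theorem far_of_far_addEdge {e : Sym2 V} {v : V} (h : Far (addEdge G e) a v) : Far G a v :=
  ⟨h.1, fun hv => h.2 (Or.inl hv)⟩

theorem far_addEdge_root {z v : V} (hz : z ≠ a) (h : Far (addEdge G s(a, z)) a v) :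
    Far G a v ∧ v ≠ z := by
  refine ⟨far_of_far_addEdge h, ?_⟩
  rintro rfl
  exact h.2 (addEdge_adj.2 (Or.inr ⟨Or.inl ⟨rfl, rfl⟩, h.1.symm⟩))

theorem adj_of_adj_addEdge_root {z p q : V} (hp : p ≠ a) (hq : q ≠ a)
    (h : (addEdge G s(a, z)).Adj p q) : G.Adj p q := by
  rcases addEdge_adj.1 h with h | ⟨⟨h, -⟩ | ⟨-, h⟩, -⟩
  exacts [h, (hp h).elim, (hq h).elim]

theorem adj_root_of_adj_addEdge_root {z u : V} (hu : u ≠ z)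
    (h : (addEdge G s(a, z)).Adj a u) : G.Adj a u := by
  rcases addEdge_adj.1 h with h | ⟨⟨-, h⟩ | ⟨h, h'⟩, h''⟩
  exacts [h, (hu h).elim, (h'' h'.symm).elim]

theorem adj_far_edge {x y p q : V} (hpx : p ≠ x) (hpy : p ≠ y)
    (h : (addEdge G s(x, y)).Adj p q) : G.Adj p q := by
  rcases addEdge_adj.1 h with h | ⟨⟨h, -⟩ | ⟨h, -⟩, -⟩
  exacts [h, (hpx h).elim, (hpy h).elim]

theorem far_addEdge_far {x y v : V} (hx : Far G a x) (hy : Far G a y) (hv : Far G a v) :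
    Far (addEdge G s(x, y)) a v :=
  ⟨hv.1, fun h => hv.2 (adj_far_edge hx.1.symm hy.1.symm h)⟩

theorem farIndep_addEdge_root {z : V} (hz : z ≠ a)
    (hind : ∀ p q, p ≠ z → q ≠ z → Far G a p → Far G a q → ¬ G.Adj p q) :
    FarIndep (addEdge G s(a, z)) a := by
  intro p q hp hq hpq
  exact hind p q (far_addEdge_root hz hp).2 (far_addEdge_root hz hq).2 (far_addEdge_root hz hp).1
    (far_addEdge_root hz hq).1 (adj_of_adj_addEdge_root hp.1 hq.1 hpq)

theorem farIndep_answer_far (hind : FarIndep G a) {x y : V} :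
    ∀ p q, p ≠ x → q ≠ x → Far (addEdge G s(x, y)) a p → Far (addEdge G s(x, y)) a q →
      ¬ (addEdge G s(x, y)).Adj p q := by
  intro p q hpx hqx hp hq hpq
  rcases addEdge_adj.1 hpq with h | ⟨⟨h, -⟩ | ⟨-, h⟩, -⟩
  exacts [hind p q (far_of_far_addEdge hp) (far_of_far_addEdge hq) h, hpx h, hqx h]

theorem legalMove_root {z : V} (hz : Far G a z) (hc : (addEdge G s(a, z)).Colorable 3) :
    legalMove (chiGt 3) G s(a, z) :=
  ⟨by simpa using hz.1.symm, by simpa using hz.2, not_chiGt_iff.2 hc⟩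

/-- A vertex far from `a` can be joined to `a` if all but at most one of the common neighbours
have no further neighbours. -/
theorem colorable_addEdge_of_pendant {z : V} (hG : G.Colorable 3) (hz : Far G a z)
    (hind : ∀ p q, p ≠ z → q ≠ z → Far G a p → Far G a q → ¬ G.Adj p q) (y : V)
    (hy : ∀ u, u ≠ y → G.Adj a u → G.Adj z u → ∀ w, G.Adj u w → w = a ∨ w = z) :
    (addEdge G s(a, z)).Colorable 3 := by
  classical
  obtain ⟨c⟩ := hG
  have third : ∀ α β : Fin 3, ∃ t, t ≠ α ∧ t ≠ β := by decide
  obtain ⟨t, hta, hty⟩ := third (c a) (c y)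
  obtain ⟨s, hsa, hst⟩ := third (c a) t
  let f : V → Fin 3 := fun p =>
    if p = z then t else if G.Adj a p then (if G.Adj z p ∧ p ≠ y then s else c p) else c a
  have hfa : f a = c a := by simp [f, hz.1.symm]
  have hfz : f z = t := by simp [f]
  have hf1 : ∀ p, p ≠ z → G.Adj a p → G.Adj z p → p ≠ y → f p = s := by
    intro p h1 h2 h3 h4; simp [f, h1, h2, h3, h4]
  have hf2 : ∀ p, p ≠ z → G.Adj a p → ¬ (G.Adj z p ∧ p ≠ y) → f p = c p := by
    intro p h1 h2 h3; simp only [f, h1, h2, h3, if_true, if_false]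
  have hf3 : ∀ p, p ≠ z → ¬ G.Adj a p → f p = c a := by
    intro p h1 h2; simp [f, h1, h2]
  have hne : ∀ p, G.Adj a p → f p ≠ c a := by
    intro p hp
    have hpz : p ≠ z := fun h => hz.2 (h ▸ hp)
    by_cases h : G.Adj z p ∧ p ≠ y
    · rw [hf1 p hpz hp h.1 h.2]; exact hsa
    · rw [hf2 p hpz hp h]; exact (c.valid hp).symm
  have hzp : ∀ p, G.Adj z p → f p ≠ t := by
    intro p hp
    have hpz : p ≠ z := hp.ne'
    by_cases hap : G.Adj a p
    · by_cases h : p = y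
      · rw [hf2 p hpz hap (by simp [h]), h]; exact hty.symm
      · rw [hf1 p hpz hap hp h]; exact hst
    · rw [hf3 p hpz hap]; exact hta.symm
  have hpend : ∀ p q, p ≠ z → q ≠ z → G.Adj a p → G.Adj a q → G.Adj p q →
      ¬ (G.Adj z p ∧ p ≠ y) := by
    rintro p q - hq hap haq hpq ⟨h1, h2⟩
    rcases hy p h2 hap h1 q hpq with h | h
    · exact haq.ne' h
    · exact hq h
  let c' : G.Coloring (Fin 3) := Coloring.mk f fun {p q} hpq => by
    by_cases hp : p = z
    · subst hp; rw [hfz]; exact (hzp q hpq).symm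
    by_cases hq : q = z
    · subst hq; rw [hfz]; exact hzp p hpq.symm
    by_cases hap : G.Adj a p
    · by_cases haq : G.Adj a q
      · rw [hf2 p hp hap (hpend p q hp hq hap haq hpq),
          hf2 q hq haq (hpend q p hq hp haq hap hpq.symm)]
        exact c.valid hpq
      · rw [hf3 q hq haq]; exact hne p hap
    · by_cases haq : G.Adj a q
      · rw [hf3 p hp hap]; exact (hne q haq).symm
      · have hpa : p ≠ a := by rintro rfl; exact haq hpq
        have hqa : q ≠ a := by rintro rfl; exact hap hpq.symm
        exact (hind p q hp hq ⟨hpa, hap⟩ ⟨hqa, haq⟩ hpq).elim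
  refine colorable_addEdge c' ?_
  change f a ≠ f z
  rw [hfa, hfz]; exact hta.symm

variable [Fintype V]

theorem weight_le_weight {d e : ℕ} (h : d ≤ e) : weight d ≤ weight e := by
  unfold weight; split_ifs <;> omega

theorem commonDeg_le (v : V) (h : ∀ u, G'.Adj a u → G'.Adj v u → G.Adj a u ∧ G.Adj v u) :
    commonDeg G' a v ≤ commonDeg G a v := by
  classical
  refine Finset.card_le_card fun u hu => ?_
  simp only [Finset.mem_filter, Finset.mem_univ, true_and] at hu ⊢
  exact h u hu.1 hu.2

theorem commonDeg_le_succ (v o : V)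
    (h : ∀ u, u ≠ o → G'.Adj a u → G'.Adj v u → G.Adj a u ∧ G.Adj v u) :
    commonDeg G' a v ≤ commonDeg G a v + 1 := by
  classical
  refine (Finset.card_le_card (t := insert o (Finset.univ.filter fun u => G.Adj a u ∧ G.Adj v u))
    fun u hu => ?_).trans (Finset.card_insert_le _ _)
  simp only [Finset.mem_insert, Finset.mem_filter, Finset.mem_univ, true_and] at hu ⊢
  exact or_iff_not_imp_left.2 fun ho => h u ho hu.1 hu.2

theorem commonDeg_eq_zero {v : V} :
    commonDeg G a v = 0 ↔ ∀ u, G.Adj a u → ¬ G.Adj v u := by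
  classical
  simp [commonDeg, Finset.filter_eq_empty_iff]

theorem exists_unique_of_commonDeg_eq_one {v : V} (h : commonDeg G a v = 1) :
    ∃ u, G.Adj a u ∧ G.Adj v u ∧ ∀ u', G.Adj a u' → G.Adj v u' → u' = u := by
  classical
  obtain ⟨u, hu⟩ := Finset.card_eq_one.1 h
  simp only [Finset.ext_iff, Finset.mem_filter, Finset.mem_univ, true_and,
    Finset.mem_singleton] at hu
  exact ⟨u, ((hu u).2 rfl).1, ((hu u).2 rfl).2, fun u' h1 h2 => (hu u').1 ⟨h1, h2⟩⟩

theorem exists_of_commonDeg_le_one {v : V} (h : commonDeg G a v ≤ 1) :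
    ∃ y, ∀ u, G.Adj a u → G.Adj v u → u = y := by
  rcases Nat.le_one_iff_eq_zero_or_eq_one.1 h with h | h
  · exact ⟨a, fun u hu hv => (commonDeg_eq_zero.1 h u hu hv).elim⟩
  · obtain ⟨y, -, -, hy⟩ := exists_unique_of_commonDeg_eq_one h
    exact ⟨y, hy⟩

open scoped Classical in
theorem add_le_potential (x y : V) (α β : ℤ)
    (h : ∀ v, localPotential G a v + (if v = x then α else 0) + (if v = y then β else 0)
      ≤ localPotential G' a v) :
    potential G a + α + β ≤ potential G' a := by
  have := Finset.sum_le_sum fun v (_ : v ∈ Finset.univ) => h v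
  simpa [Finset.sum_add_distrib, potential] using this

theorem localPotential_le_of_far_imp {v : V} {k : ℤ}
    (hN : ∀ u, G.Adj a u → G'.Adj a u) (hk : 0 ≤ k)
    (hw : Far G' a v → weight (commonDeg G' a v) ≤ weight (commonDeg G a v) + k) :
    localPotential G a v - k ≤ localPotential G' a v := by
  have hnn : 0 ≤ weight (commonDeg G a v) := by unfold weight; split_ifs <;> omega
  unfold localPotential
  by_cases hva : v = a
  · simp [hva, hk]
  by_cases h1 : G.Adj a v
  · simp [hva, h1, hN v h1, hk]
  by_cases h2 : G'.Adj a v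
  · simp only [hva, h1, h2, if_true, if_false]; omega
  · have := hw ⟨hva, h2⟩
    simp only [hva, h1, h2, if_false]; omega

theorem colorable_addEdge_of_commonDeg_le_one {z : V} (hG : G.Colorable 3) (hz : Far G a z)
    (hind : ∀ p q, p ≠ z → q ≠ z → Far G a p → Far G a q → ¬ G.Adj p q)
    (hd : commonDeg G a z ≤ 1) : (addEdge G s(a, z)).Colorable 3 := by
  obtain ⟨y, hy⟩ := exists_of_commonDeg_le_one hd
  exact colorable_addEdge_of_pendant hG hz hind y fun u hu h1 h2 => (hu (hy u h1 h2)).elim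

/-! ### Effect of joining a vertex to the root -/

theorem localPotential_of_far {v : V} (h : Far G a v) :
    localPotential G a v = - weight (commonDeg G a v) := by
  simp [localPotential, h.1, h.2]

theorem potential_addEdge_root {z : V} (hz : Far G a z) (hind : FarIndep G a) :
    potential G a + (1 + weight (commonDeg G a z)) ≤ potential (addEdge G s(a, z)) a := by
  classical
  have := add_le_potential (G := G) (G' := addEdge G s(a, z)) (a := a) z z
    (1 + weight (commonDeg G a z)) 0 fun v => ?_
  · simpa using this
  by_cases hv : v = z
  · subst hv
    rw [localPotential_of_far hz]
    have : (addEdge G s(a, v)).Adj a v := addEdge_adj.2 (Or.inr ⟨Or.inl ⟨rfl, rfl⟩, hz.1.symm⟩)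
    simp [localPotential, hz.1, this]
  · have := localPotential_le_of_far_imp (G := G) (G' := addEdge G s(a, z)) (a := a) (v := v)
      (k := 0) (fun u hu => Or.inl hu) le_rfl fun hf => by
        rw [add_zero]
        refine weight_le_weight (commonDeg_le v fun u hu hvu => ?_)
        have hvu' := adj_of_adj_addEdge_root hf.1 hu.ne' hvu
        refine ⟨adj_root_of_adj_addEdge_root ?_ hu, hvu'⟩
        rintro rfl
        exact hind v u (far_of_far_addEdge hf) hz hvu'
    simpa [hv] using this

theorem largeDegree_of_forced (hG : G.Colorable 3) (hind : FarIndep G a)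
    (hS : -1 ≤ potential G a)
    (hforced : ∀ z, Far G a z → ¬ (addEdge G s(a, z)).Colorable 3) : LargeDegree G a := by
  classical
  have key : ∀ v, localPotential G a v ≤
      (if G.Adj a v then 4 else 0) + (if v = a then 3 else 0) + (-3) := by
    intro v
    by_cases hva : v = a
    · subst hva; simp [localPotential]
    by_cases hv : G.Adj a v
    · simp [localPotential, hva, hv]
    · have h2 : ¬ commonDeg G a v ≤ 1 := fun h => hforced v ⟨hva, hv⟩
        (colorable_addEdge_of_commonDeg_le_one hG ⟨hva, hv⟩ (fun p q _ _ => hind p q) h)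
      have : weight (commonDeg G a v) = 3 := by unfold weight; split_ifs <;> omega
      simp [localPotential, hva, hv, this]
  have hsum := Finset.sum_le_sum fun v (_ : v ∈ Finset.univ) => key v
  have h4 : ∑ v, (if G.Adj a v then (4 : ℤ) else 0) =
      4 * ((Finset.univ.filter fun v => G.Adj a v).card : ℤ) := by
    rw [← Finset.sum_filter, Finset.sum_const, nsmul_eq_mul, mul_comm]
  rw [Finset.sum_add_distrib, Finset.sum_add_distrib, h4] at hsum
  simp only [Finset.sum_ite_eq', Finset.mem_univ, if_true, Finset.sum_const, Finset.card_univ,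
    nsmul_eq_mul] at hsum
  unfold potential at hS
  unfold LargeDegree
  omega

/-- A position without edges between non-neighbours of `a` and with potential at least `-1`
is good for Mini when it is her turn. -/
theorem exists_root_move (hG : G.Colorable 3) (hind : FarIndep G a) (hS : -1 ≤ potential G a) :
    LargeDegree G a ∨ ∃ z, Far G a z ∧ MiniInvariant (addEdge G s(a, z)) a := by
  by_cases hfree : ∃ z, Far G a z ∧ (addEdge G s(a, z)).Colorable 3
  swap
  · push Not at hfree
    exact Or.inl (largeDegree_of_forced hG hind hS hfree)
  right
  have hind' := fun {z : V} (hz : Far G a z) =>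
    farIndep_addEdge_root hz.1 fun p q (_ : p ≠ z) (_ : q ≠ z) => hind p q
  by_cases hpos : ∃ z, Far G a z ∧ (addEdge G s(a, z)).Colorable 3 ∧ commonDeg G a z ≠ 0
  · obtain ⟨z, hz, hc, hd⟩ := hpos
    have h1 : 1 ≤ weight (commonDeg G a z) := by unfold weight; split_ifs <;> omega
    have h2 := potential_addEdge_root hz hind
    exact ⟨z, hz, hc, hind' hz, by omega, Or.inl (by omega)⟩
  · push Not at hpos
    obtain ⟨z, hz, hc⟩ := hfree
    have h1 := hpos z hz hc
    have h2 := potential_addEdge_root hz hind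
    rw [h1] at h2
    have h3 : weight 0 = 0 := rfl
    refine ⟨z, hz, hc, hind' hz, by omega, Or.inr fun p u hp hu hpu huniq => ?_⟩
    exfalso
    have hp' := far_addEdge_root hz.1 hp
    have hpu' := adj_of_adj_addEdge_root hp.1 hu.ne' hpu
    have hau : G.Adj a u := adj_root_of_adj_addEdge_root
      (by rintro rfl; exact hind p u hp'.1 hz hpu') hu
    refine commonDeg_eq_zero.1 (hpos p hp'.1 ?_) u hau hpu'
    exact colorable_addEdge_of_pendant hG hp'.1 (fun p q _ _ => hind p q) u fun u' hne h1 h2 =>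
      (hne (huniq u' (Or.inl h1) (Or.inl h2))).elim

/-! ### Mini's answers to the moves of Max -/

theorem answer_root_edge (hG : MiniInvariant G a) {x : V} (hx : Far G a x)
    (hc : (addEdge G s(a, x)).Colorable 3) :
    LargeDegree (addEdge G s(a, x)) a ∨ ∃ z, Far (addEdge G s(a, x)) a z ∧
      MiniInvariant (addEdge (addEdge G s(a, x)) s(a, z)) a := by
  have h1 := potential_addEdge_root hx hG.indep
  have h2 : 0 ≤ weight (commonDeg G a x) := by unfold weight; split_ifs <;> omega
  have h3 := hG.nonneg
  exact exists_root_move hc (farIndep_addEdge_root hx.1 fun p q _ _ => hG.indep p q) (by omega)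

theorem answer_near_edge (hG : MiniInvariant G a) {x y : V} (hx : x ≠ a) (hy : G.Adj a y)
    (hxy : ¬ G.Adj x y) (hc : (addEdge G s(x, y)).Colorable 3) :
    LargeDegree (addEdge G s(x, y)) a ∨ ∃ z, Far (addEdge G s(x, y)) a z ∧
      MiniInvariant (addEdge (addEdge G s(x, y)) s(a, z)) a := by
  classical
  have hroot : ∀ u, (addEdge G s(x, y)).Adj a u → G.Adj a u := by
    intro u hu
    rcases addEdge_adj.1 hu with h | ⟨⟨h, -⟩ | ⟨h, -⟩, -⟩
    exacts [h, (hx h.symm).elim, (hy.ne h).elim]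
  have hadj : ∀ {p q}, p ≠ x → Far G a p → (addEdge G s(x, y)).Adj p q → G.Adj p q := by
    intro p q hpx hp hpq
    rcases addEdge_adj.1 hpq with h | ⟨⟨h, -⟩ | ⟨h, -⟩, -⟩
    exacts [h, (hpx h).elim, (hp.2 (h ▸ hy)).elim]
  have hind : FarIndep (addEdge G s(x, y)) a := by
    intro p q hp hq hpq
    have hp' := far_of_far_addEdge hp
    have hq' := far_of_far_addEdge hq
    rcases addEdge_adj.1 hpq with h | ⟨⟨-, h⟩ | ⟨h, -⟩, -⟩
    exacts [hG.indep p q hp' hq' h, hq'.2 (h ▸ hy), hp'.2 (h ▸ hy)]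
  have hpot : ∀ k : ℤ, 0 ≤ k → (Far G a x → weight (commonDeg G a x + 1) ≤
      weight (commonDeg G a x) + k) → potential G a - k ≤ potential (addEdge G s(x, y)) a := by
    intro k hk hkx
    have := add_le_potential (G := G) (G' := addEdge G s(x, y)) (a := a) x x (-k) 0 fun v => ?_
    · simpa [sub_eq_add_neg] using this
    have hcase := localPotential_le_of_far_imp (G := G) (G' := addEdge G s(x, y)) (a := a) (v := v)
      (k := if v = x then k else 0) (fun u hu => Or.inl hu) (by split_ifs <;> omega) fun hf => by
        have hf' := far_of_far_addEdge hf
        by_cases hv : v = x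
        · subst hv
          rw [if_pos rfl]
          refine (weight_le_weight (commonDeg_le_succ v y fun u hu hau hvu => ?_)).trans (hkx hf')
          refine ⟨hroot u hau, ?_⟩
          rcases addEdge_adj.1 hvu with h | ⟨⟨-, h⟩ | ⟨-, h⟩, h'⟩
          exacts [h, (hu h).elim, (h' h.symm).elim]
        · rw [if_neg hv, add_zero]
          exact weight_le_weight (commonDeg_le v fun u hau hvu => ⟨hroot u hau, hadj hv hf' hvu⟩)
    split_ifs at hcase ⊢ <;> omega
  have hnn := hG.nonneg
  by_cases hbad : Far G a x ∧ commonDeg G a x = 1 ∧ ¬ 1 ≤ potential G a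
  · obtain ⟨hfx, hd, hpos⟩ := hbad
    have hclean := hG.pos_or_clean.resolve_left hpos
    have hfx' : Far (addEdge G s(x, y)) a x := ⟨hx, fun h => hfx.2 (hroot x h)⟩
    obtain ⟨u, hau, hxu, huniq⟩ := exists_unique_of_commonDeg_eq_one hd
    right
    have hcol : (addEdge (addEdge G s(x, y)) s(a, x)).Colorable 3 := by
      refine colorable_addEdge_of_pendant hc hfx' (fun p q _ _ => hind p q) y ?_
      intro u' hne hau' hxu' w hw
      have hxu'' : G.Adj x u' := by
        rcases addEdge_adj.1 hxu' with h | ⟨⟨-, h⟩ | ⟨-, h⟩, h'⟩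
        exacts [h, (hne h).elim, (h' h.symm).elim]
      have hu' := huniq u' (hroot u' hau') hxu''
      subst hu'
      refine hclean x u' hfx hau hxu huniq w ?_
      rcases addEdge_adj.1 hw with h | ⟨⟨h, -⟩ | ⟨h, -⟩, -⟩
      exacts [h, (hxu.ne h.symm).elim, (hne h).elim]
    have hp1 := hpot 2 (by omega) fun _ => by rw [hd]; decide
    have hp2 := potential_addEdge_root hfx' hind
    have hw : weight (commonDeg G a x) ≤ weight (commonDeg (addEdge G s(x, y)) a x) :=
      weight_le_weight (commonDeg_le x fun u h1 h2 => ⟨Or.inl h1, Or.inl h2⟩)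
    have hw1 : weight (commonDeg G a x) = 1 := by rw [hd]; rfl
    by_cases hw2 : 2 ≤ commonDeg (addEdge G s(x, y)) a x
    · have : weight (commonDeg (addEdge G s(x, y)) a x) = 3 := by
        unfold weight; split_ifs <;> omega
      exact ⟨x, hfx', hcol, farIndep_addEdge_root hx fun p q _ _ => hind p q, by omega,
        Or.inl (by omega)⟩
    · exfalso
      obtain ⟨v, hv⟩ := exists_of_commonDeg_le_one (Nat.le_of_lt_succ (not_le.1 hw2))
      have e1 := hv u (Or.inl hau) (Or.inl hxu)
      have e2 := hv y (Or.inl hy)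
        (addEdge_adj.2 (Or.inr ⟨Or.inl ⟨rfl, rfl⟩, fun h => hfx.2 (h ▸ hy)⟩))
      exact hxy (e2.trans e1.symm ▸ hxu)
  · refine exists_root_move hc hind ?_
    by_cases hfx : Far G a x
    · by_cases hd : commonDeg G a x = 1
      · have h1 : 1 ≤ potential G a := by by_contra h; exact hbad ⟨hfx, hd, h⟩
        have := hpot 2 (by omega) fun _ => by rw [hd]; decide
        omega
      · have := hpot 1 (by omega) fun _ => by unfold weight; split_ifs <;> omega
        omega
    · have := hpot 0 le_rfl fun h => (hfx h).elim
      omega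

theorem potential_answer_far (hind : FarIndep G a) {x y : V} (hx : Far G a x) (hy : Far G a y)
    (hxy : x ≠ y) :
    potential G a + (1 + weight (commonDeg G a x)) +
      (weight (commonDeg G a y) - weight (commonDeg G a y + 1)) ≤
      potential (addEdge (addEdge G s(x, y)) s(a, x)) a := by
  classical
  refine add_le_potential x y _ _ fun v => ?_
  have hroot : ∀ u, u ≠ x → (addEdge (addEdge G s(x, y)) s(a, x)).Adj a u → G.Adj a u :=
    fun u hu h => adj_far_edge hx.1.symm hy.1.symm (adj_root_of_adj_addEdge_root hu h)
  by_cases hvx : v = x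
  · subst hvx
    rw [localPotential_of_far hx]
    have : (addEdge (addEdge G s(v, y)) s(a, v)).Adj a v :=
      addEdge_adj.2 (Or.inr ⟨Or.inl ⟨rfl, rfl⟩, hx.1.symm⟩)
    simp [localPotential, hx.1, this, hxy]
  have hmono := weight_le_weight (Nat.le_add_right (commonDeg G a y) 1)
  have := localPotential_le_of_far_imp (G := G) (G' := addEdge (addEdge G s(x, y)) s(a, x))
    (a := a) (v := v)
    (k := if v = y then weight (commonDeg G a y + 1) - weight (commonDeg G a y) else 0)
    (fun u hu => Or.inl (Or.inl hu)) (by split_ifs <;> omega) fun hf => by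
      by_cases hvy : v = y
      · subst hvy
        rw [if_pos rfl, add_sub_cancel]
        refine weight_le_weight (commonDeg_le_succ v x fun u hu hau hvu => ?_)
        refine ⟨hroot u hu hau, ?_⟩
        have hvu' := adj_of_adj_addEdge_root hf.1 hau.ne' hvu
        rcases addEdge_adj.1 hvu' with h | ⟨⟨h, -⟩ | ⟨-, h⟩, -⟩
        exacts [h, (hvx h).elim, (hu h).elim]
      · rw [if_neg hvy, add_zero]
        refine weight_le_weight (commonDeg_le v fun u hau hvu => ?_)
        have hvu' := adj_far_edge hvx hvy (adj_of_adj_addEdge_root hf.1 hau.ne' hvu)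
        refine ⟨hroot u ?_ hau, hvu'⟩
        rintro rfl
        exact hind v u (far_of_far_addEdge (far_of_far_addEdge hf)) hx hvu'
  rw [if_neg hvx]
  split_ifs at this ⊢ <;> omega

theorem clean_answer_far (hind : FarIndep G a) (hclean : Clean G a) {x y : V} (hx : Far G a x)
    (hy : Far G a y) (hxy : x ≠ y) (hd : commonDeg G a x = commonDeg G a y) :
    Clean (addEdge (addEdge G s(x, y)) s(a, x)) a := by
  intro p u hp hau hpu huniq w huw
  obtain ⟨hp1, hpx⟩ := far_addEdge_root hx.1 hp
  have hp0 := far_of_far_addEdge hp1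
  have hpu1 := adj_of_adj_addEdge_root hp.1 hau.ne' hpu
  have hroot : ∀ u, u ≠ x → (addEdge (addEdge G s(x, y)) s(a, x)).Adj a u → G.Adj a u :=
    fun u hu h => adj_far_edge hx.1.symm hy.1.symm (adj_root_of_adj_addEdge_root hu h)
  by_cases hwa : w = a
  · exact Or.inl hwa
  right
  have huw1 := adj_of_adj_addEdge_root hau.ne' hwa huw
  by_cases hpy : p = y
  · subst hpy
    have hxu : x = u := huniq x (addEdge_adj.2 (Or.inr ⟨Or.inl ⟨rfl, rfl⟩, hx.1.symm⟩))
      (Or.inl (addEdge_adj.2 (Or.inr ⟨Or.inr ⟨rfl, rfl⟩, hpx⟩)))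
    subst hxu
    have hd0 : commonDeg G a p = 0 := commonDeg_eq_zero.2 fun u' h1 h2 =>
      hx.2 (huniq u' (Or.inl (Or.inl h1)) (Or.inl (Or.inl h2)) ▸ h1)
    rcases addEdge_adj.1 huw1 with h | ⟨⟨-, h⟩ | ⟨h, -⟩, -⟩
    · exfalso
      by_cases haw : G.Adj a w
      · exact commonDeg_eq_zero.1 (hd.trans hd0) w haw h
      · exact hind x w hx ⟨hwa, haw⟩ h
    · exact h
    · exact (hxy h).elim
  · have hpu0 := adj_far_edge hpx hpy hpu1
    have hux : u ≠ x := by rintro rfl; exact hind p u hp0 hx hpu0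
    have hau0 := hroot u hux hau
    have huy : u ≠ y := by rintro rfl; exact hy.2 hau0
    exact (hclean p u hp0 hau0 hpu0
      (fun u' h1 h2 => huniq u' (Or.inl (Or.inl h1)) (Or.inl (Or.inl h2))) w
      (adj_far_edge hux huy huw1)).resolve_left hwa

theorem answer_far_edge (hG : MiniInvariant G a) {x y : V} (hx : Far G a x) (hy : Far G a y)
    (hxy : x ≠ y) (hle : commonDeg G a y ≤ commonDeg G a x)
    (hc : (addEdge G s(x, y)).Colorable 3) :
    ∃ z, Far (addEdge G s(x, y)) a z ∧
      MiniInvariant (addEdge (addEdge G s(x, y)) s(a, z)) a := by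
  have hx' := far_addEdge_far hx hy hx
  have hnn := hG.nonneg
  have hpx := potential_answer_far hG.indep hx hy hxy
  by_cases hcx : (addEdge (addEdge G s(x, y)) s(a, x)).Colorable 3
  · have hind := farIndep_addEdge_root hx.1 (farIndep_answer_far (y := y) hG.indep)
    by_cases heq : commonDeg G a x = commonDeg G a y ∧ ¬ 1 ≤ potential G a
    · have hclean := hG.pos_or_clean.resolve_left heq.2
      refine ⟨x, hx', hcx, hind, ?_, Or.inr (clean_answer_far hG.indep hclean hx hy hxy heq.1)⟩
      rw [heq.1] at hpx
      unfold weight at hpx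
      split_ifs at hpx <;> omega
    · have : 1 ≤ potential (addEdge (addEdge G s(x, y)) s(a, x)) a := by
        unfold weight at hpx
        split_ifs at hpx <;> omega
      exact ⟨x, hx', hcx, hind, by omega, Or.inl this⟩
  · have hdx : ¬ commonDeg G a x ≤ 1 := fun h =>
      hcx <| colorable_addEdge_of_commonDeg_le_one hc hx' (farIndep_answer_far hG.indep) <|
        (commonDeg_le x fun u hau hxu => by
          have hau' := adj_far_edge hx.1.symm hy.1.symm hau
          refine ⟨hau', ?_⟩
          rcases addEdge_adj.1 hxu with h | ⟨⟨-, h⟩ | ⟨h, -⟩, -⟩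
          exacts [h, (hy.2 (h ▸ hau')).elim, (hxy h).elim]).trans h
    have hcy : (addEdge (addEdge G s(x, y)) s(a, y)).Colorable 3 := by
      obtain ⟨c⟩ := hc
      by_cases h : c a = c x
      · refine colorable_addEdge c fun h' => c.valid (v := x) (w := y) ?_ (h.symm.trans h')
        exact addEdge_adj.2 (Or.inr ⟨Or.inl ⟨rfl, rfl⟩, hxy⟩)
      · exact (hcx (colorable_addEdge c h)).elim
    have hpy := potential_answer_far hG.indep hy hx hxy.symm
    have hind := farIndep_addEdge_root hy.1 (farIndep_answer_far (y := x) hG.indep)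
    rw [Sym2.eq_swap (a := y) (b := x)] at hpy hind
    have : 1 ≤ potential (addEdge (addEdge G s(x, y)) s(a, y)) a := by
      unfold weight at hpy
      split_ifs at hpy <;> omega
    exact ⟨y, far_addEdge_far hx hy hy, hcy, hind, by omega, Or.inl this⟩

theorem exists_answer (hG : MiniInvariant G a) {e : Sym2 V} (he : legalMove (chiGt 3) G e) :
    LargeDegree (addEdge G e) a ∨
      ∃ z, Far (addEdge G e) a z ∧ MiniInvariant (addEdge (addEdge G e) s(a, z)) a := by
  induction e with
  | _ x y =>
  obtain ⟨hxy, hnadj, hc⟩ := he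
  rw [not_chiGt_iff] at hc
  rw [Sym2.mk_isDiag_iff] at hxy
  rw [mem_edgeSet] at hnadj
  by_cases hxa : x = a
  · subst hxa; exact answer_root_edge hG ⟨Ne.symm hxy, hnadj⟩ hc
  by_cases hya : y = a
  · subst hya
    rw [Sym2.eq_swap] at hc ⊢
    exact answer_root_edge hG ⟨hxy, fun h => hnadj h.symm⟩ hc
  by_cases hay : G.Adj a y
  · exact answer_near_edge hG hxa hay hnadj hc
  by_cases hax : G.Adj a x
  · rw [Sym2.eq_swap] at hc ⊢
    exact answer_near_edge hG hya hax (fun h => hnadj h.symm) hc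
  right
  rcases le_total (commonDeg G a y) (commonDeg G a x) with h | h
  · exact answer_far_edge hG ⟨hxa, hax⟩ ⟨hya, hay⟩ hxy h hc
  · rw [Sym2.eq_swap] at hc ⊢
    exact answer_far_edge hG ⟨hya, hay⟩ ⟨hxa, hax⟩ (Ne.symm hxy) h hc

theorem LargeDegree.mono (h : LargeDegree G a) (hle : G ≤ G') : LargeDegree G' a := by
  classical
  unfold LargeDegree at h ⊢
  have := Finset.card_le_card (Finset.monotone_filter_right Finset.univ
    (p := fun v => G.Adj a v) (q := fun v => G'.Adj a v) fun v _ hv => hle hv)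
  convert h.trans (Nat.add_le_add_right (Nat.mul_le_mul_left 4 this) 4) using 1

theorem gameEnsures_of_largeDegree {Q : SimpleGraph V → Prop}
    (hQ : ∀ G, G.Colorable 3 → LargeDegree G a → Q G) (turn : Bool) (hc : G.Colorable 3)
    (h : LargeDegree G a) : GameEnsures (chiGt 3) Q turn G := by
  induction G using (wellFounded_gt (α := SimpleGraph V)).induction generalizing turn with
  | _ G ih =>
  by_cases hend : ∀ e, ¬ legalMove (chiGt 3) G e
  · exact .gameOver turn G hend (hQ G hc h)
  push Not at hend
  obtain ⟨e, he⟩ := hend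
  have next : ∀ e t, legalMove (chiGt 3) G e → GameEnsures (chiGt 3) Q t (addEdge G e) :=
    fun e t he => ih _ (lt_addEdge he) t (not_chiGt_iff.1 he.2.2) (h.mono (lt_addEdge he).le)
  cases turn
  · exact .opponentMove G e he fun e he => next e true he
  · exact .protagonistMove G e he (next e false he)

theorem MiniInvariant.gameEnsures {Q : SimpleGraph V → Prop}
    (hQ : ∀ G, G.Colorable 3 → LargeDegree G a → Q G) (h : MiniInvariant G a) :
    GameEnsures (chiGt 3) Q false G := by
  induction G using (wellFounded_gt (α := SimpleGraph V)).induction with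
  | _ G ih =>
  by_cases hend : ∀ e, ¬ legalMove (chiGt 3) G e
  · have hnn := h.nonneg
    exact .gameOver false G hend (hQ G h.colorable (largeDegree_of_forced h.colorable h.indep
      (by omega) fun z hz hc => hend _ (legalMove_root hz hc)))
  push Not at hend
  obtain ⟨e₀, he₀⟩ := hend
  refine .opponentMove G e₀ he₀ fun e he => ?_
  rcases exists_answer h he with hl | ⟨z, hz, hinv⟩
  · exact gameEnsures_of_largeDegree hQ true (not_chiGt_iff.1 he.2.2) hl
  · have hz' := legalMove_root hz hinv.colorable
    exact .protagonistMove _ _ hz' (ih _ ((lt_addEdge he).trans (lt_addEdge hz')) hinv)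

theorem miniInvariant_bot (a : V) : MiniInvariant (⊥ : SimpleGraph V) a where
  colorable := ⟨Coloring.mk (fun _ => 0) fun h => h.elim⟩
  indep _ _ _ _ h := h
  nonneg := Finset.sum_nonneg fun v _ => by simp [localPotential, commonDeg, weight]
  pos_or_clean := Or.inr fun _ _ _ h => h.elim

/-- A graph with a 3-colouring in which some vertex has large degree has few edges. -/
theorem LargeDegree.edgeSet_ncard_le (hc : G.Colorable 3) (h : LargeDegree G a) :
    (G.edgeSet.ncard : ℝ) ≤
      21 * (Fintype.card V : ℝ) ^ 2 / 64 + 1 * (Fintype.card V : ℝ) := by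
  classical
  obtain ⟨c⟩ := hc
  let s : Fin 3 → ℕ := fun i => (Finset.univ.filter fun v => c v = i).card
  have hs : ∑ i, s i = Fintype.card V :=
    (Finset.card_eq_sum_card_fiberwise (f := c) (s := Finset.univ) (t := Finset.univ)
      (by simp)).symm
  have hdeg : ∀ v, G.degree v + s (c v) ≤ Fintype.card V := by
    intro v
    rw [← card_neighborFinset_eq_degree, ← Finset.card_union_of_disjoint]
    · exact Finset.card_le_univ _
    · refine Finset.disjoint_left.2 fun w hw hw' => ?_
      rw [mem_neighborFinset] at hw
      exact c.valid hw (Finset.mem_filter.1 hw').2.symm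
  have hsq : ∑ v, s (c v) = ∑ i, s i * s i := by
    rw [← Finset.sum_fiberwise_of_maps_to (g := c) (t := Finset.univ) (by simp)]
    refine Finset.sum_congr rfl fun i _ => ?_
    rw [Finset.sum_congr rfl (g := fun _ => s i) fun v hv => by rw [(Finset.mem_filter.1 hv).2]]
    rw [Finset.sum_const, smul_eq_mul]
  have hE : 2 * G.edgeSet.ncard + ∑ i, s i * s i ≤ Fintype.card V * Fintype.card V := by
    have h1 : G.edgeSet.ncard = G.edgeFinset.card := by
      rw [← coe_edgeFinset, Set.ncard_coe_finset]
    rw [h1, ← sum_degrees_eq_twice_card_edges, ← hsq, ← Finset.sum_add_distrib]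
    refine (Finset.sum_le_sum fun v _ => hdeg v).trans ?_
    simp
  have hclass : 4 * s (c a) ≤ Fintype.card V + 4 := by
    have h1 := hdeg a
    rw [← card_neighborFinset_eq_degree, neighborFinset_eq_filter] at h1
    unfold LargeDegree at h
    omega
  have key : ∀ x y z n E : ℝ, 0 ≤ n → x + y + z = n → 4 * x ≤ n + 4 →
      2 * E + (x * x + y * y + z * z) ≤ n * n → E ≤ 21 * n ^ 2 / 64 + 1 * n := by
    intro x y z n E hn hsum hx hE
    nlinarith [sq_nonneg (y - z), sq_nonneg (4 * x - n), mul_nonneg hn (sub_nonneg.2 hx)]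
  rw [Fin.sum_univ_three] at hs hE
  have hs' : (s 0 : ℝ) + s 1 + s 2 = Fintype.card V := by exact_mod_cast hs
  have hE' : 2 * (G.edgeSet.ncard : ℝ) + (s 0 * s 0 + s 1 * s 1 + s 2 * s 2) ≤
      Fintype.card V * Fintype.card V := by exact_mod_cast hE
  have hclass' : 4 * (s (c a) : ℝ) ≤ Fintype.card V + 4 := by exact_mod_cast hclass
  have hn : (0 : ℝ) ≤ Fintype.card V := Nat.cast_nonneg _
  generalize c a = i at hclass'
  obtain rfl | rfl | rfl : i = 0 ∨ i = 1 ∨ i = 2 := by fin_cases i <;> simp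
  · exact key _ (s 1) (s 2) _ _ hn hs' hclass' hE'
  · exact key _ (s 0) (s 2) _ _ hn (by linarith) hclass' (by linarith)
  · exact key _ (s 0) (s 1) _ _ hn (by linarith) hclass' (by linarith)

end Potential

/-- In the saturation game `(n, χ_{>3})`, Mini (moving first or second) can guarantee a
final score of at most `21 n² / 64 + O(n)`. -/
theorem statement_2 :
    ∃ D : ℝ, ∀ n : ℕ, ∀ turn : Bool,
      GameEnsures (chiGt 3)
        (fun G : SimpleGraph (Fin n) =>
          (G.edgeSet.ncard : ℝ) ≤ 21 * (n : ℝ) ^ 2 / 64 + D * (n : ℝ))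
        turn ⊥ := by
  refine ⟨1, fun n turn => ?_⟩
  rcases n.eq_zero_or_pos with rfl | hn
  · refine .gameOver turn ⊥ (fun e => ?_) (by simp)
    induction e with
    | _ x y => exact x.elim0
  let a : Fin n := ⟨0, hn⟩
  have hQ : ∀ G : SimpleGraph (Fin n), G.Colorable 3 → LargeDegree G a →
      (G.edgeSet.ncard : ℝ) ≤ 21 * (n : ℝ) ^ 2 / 64 + 1 * (n : ℝ) := fun G hc h => by
    simpa only [Fintype.card_fin] using h.edgeSet_ncard_le hc
  have hbot := miniInvariant_bot a
  cases turn
  · exact hbot.gameEnsures hQ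
  have hnn := hbot.nonneg
  rcases exists_root_move hbot.colorable hbot.indep (by omega) with h | ⟨z, hz, hinv⟩
  · exact gameEnsures_of_largeDegree hQ true hbot.colorable h
  · exact .protagonistMove _ _ (legalMove_root hz hinv.colorable) (hinv.gameEnsures hQ)
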